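/- For x_1, …, x_n ∈ [0,1] with ∑_i x_i ≥ c for some c ∈ [0,1], it holds that 1 − ∏_{i=1}^n (1 − x_i) ≥ (1 − 1/e) · c. -/

import Mathlib

open Finset

/-- A product of factors `1 - x i` is at most the exponential of minus the sum of the `x i`. -/
lemma prod_one_sub_le_exp_neg_sum {ι : Type*} (s : Finset ι) (x : ι → ℝ)
    (hx : ∀ i ∈ s, x i ≤ 1) : ∏ i ∈ s, (1 - x i) ≤ Real.exp (-∑ i ∈ s, x i) := by
  rw [← sum_neg_distrib, Real.exp_sum]
  exact prod_le_prod (fun i hi => sub_nonneg.2 (hx i hi))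
    fun i _ => Real.one_sub_le_exp_neg (x i)

/-- On `[0, 1]`, the function `exp (-c)` lies below its chord. -/
lemma exp_neg_le_chord {c : ℝ} (h0 : 0 ≤ c) (h1 : c ≤ 1) :
    Real.exp (-c) ≤ 1 - (1 - 1 / Real.exp 1) * c := by
  have h := convexOn_exp.2 (Set.mem_univ 0) (Set.mem_univ (-1)) (sub_nonneg.2 h1) h0
    (sub_add_cancel 1 c)
  simp only [smul_eq_mul, mul_zero, zero_add, mul_neg, mul_one, Real.exp_zero] at h
  rw [one_div, ← Real.exp_neg]
  linarith

/-- For `x₁, …, xₙ ∈ [0,1]` with `∑ xᵢ ≥ c` and `c ∈ [0,1]`, it holds that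
`1 − ∏ (1 − xᵢ) ≥ (1 − 1/e)·c`. -/
theorem one_sub_prod_ge {n : ℕ} (x : Fin n → ℝ)
    (hx : ∀ i, 0 ≤ x i ∧ x i ≤ 1)
    (c : ℝ) (hc : 0 ≤ c ∧ c ≤ 1) (hsum : c ≤ ∑ i, x i) :
    (1 - 1 / Real.exp 1) * c ≤ 1 - ∏ i, (1 - x i) := by
  have hprod := prod_one_sub_le_exp_neg_sum univ x fun i _ => (hx i).2
  have hexp := Real.exp_le_exp.2 (neg_le_neg hsum)
  have hchord := exp_neg_le_chord hc.1 hc.2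
  linarith
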